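/- arXiv:1004.1558 — 2 statements merged into one kernel-verified Lean document; each statement's English description precedes it below -/
import Mathlib

section
/- Let I ⊆ ℝ be an interval and let f, g, h : ℝ → ℝ be continuous on I, each of which changes sign at every one of its zeros lying in the interior of I. Suppose a, b, c : ℝ → ℝ satisfy a(x)f(x) + b(x)g(x) + c(x)h(x) = 0 for all x ∈ I, where each of a, b, c has constant nonzero sign on I (i.e., each is everywhere strictly positive on I or everywhere strictly negative on I). If f and g have interlaced zeros on I and g and h have interlaced zeros on I, then f and h have interlaced zeros on I. -/
open Real Filter Topology Set

/-- Bessel function of the first kind of real order `ν`: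
`J_ν(x) = ∑ ((−1)^m / (m! Γ(m+ν+1))) (x/2)^{2m+ν}` (with `1/Γ = 0` at nonpositive
integers, which agrees with Lean's `1/0 = 0` since `Real.Gamma` vanishes there). -/
noncomputable def besselJ (ν : ℝ) (x : ℝ) : ℝ :=
  ∑' m : ℕ, ((-1 : ℝ) ^ m / (m.factorial * Real.Gamma ((m : ℝ) + ν + 1))) *
    (x / 2) ^ (2 * (m : ℝ) + ν)

/-- Bessel function of the second kind, characterized as the limit
`(J_μ(x) cos(μπ) − J_{−μ}(x)) / sin(μπ) → Y_ν(x)` as `μ → ν` through non-integer reals. -/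
noncomputable def besselY (ν : ℝ) (x : ℝ) : ℝ :=
  limUnder (𝓝[{μ : ℝ | ∀ n : ℤ, μ ≠ (n : ℝ)}] ν)
    (fun μ : ℝ => (besselJ μ x * Real.cos (μ * π) - besselJ (-μ) x) / Real.sin (μ * π))

/-- The cylinder function `C_ν(x) = cos δ · J_ν(x) − sin δ · Y_ν(x)`. -/
noncomputable def cylinder (δ ν : ℝ) (x : ℝ) : ℝ :=
  Real.cos δ * besselJ ν x - Real.sin δ * besselY ν x

/-- One direction of the interlacing property: between any two consecutive zeros of `f`
in `I` there is exactly one zero of `g`. -/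
def InterlaceHalf (f g : ℝ → ℝ) (I : Set ℝ) : Prop :=
  ∀ x₁ ∈ I, ∀ x₂ ∈ I, x₁ < x₂ → f x₁ = 0 → f x₂ = 0 →
    (∀ x ∈ Set.Ioo x₁ x₂, f x ≠ 0) →
    ∃! x, x ∈ Set.Ioo x₁ x₂ ∧ g x = 0

/-- `f` and `g` have interlaced zeros on `I`. -/
def InterlacedOn (f g : ℝ → ℝ) (I : Set ℝ) : Prop :=
  InterlaceHalf f g I ∧ InterlaceHalf g f I

/-- `f` changes sign at `x₀`: on some punctured neighbourhood, `f` has one strict sign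
on the left of `x₀` and the opposite strict sign on the right. -/
def ChangesSignAt (f : ℝ → ℝ) (x₀ : ℝ) : Prop :=
  ∃ ε > 0, ∀ x ∈ Set.Ioo (x₀ - ε) x₀, ∀ y ∈ Set.Ioo x₀ (x₀ + ε), f x * f y < 0

lemma aux_same {g : ℝ → ℝ} {p q : ℝ} (hpq : p ≤ q) (hg : ContinuousOn g (Icc p q))
    (h0 : ∀ x ∈ Icc p q, g x ≠ 0) : 0 < g p * g q := by
  by_contra hcon
  have hp := h0 p ⟨le_rfl, hpq⟩
  have hq := h0 q ⟨hpq, le_rfl⟩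
  have hlt : g p * g q < 0 := lt_of_le_of_ne (not_lt.mp hcon) (mul_ne_zero hp hq)
  rcases mul_neg_iff.mp hlt with ⟨h1, h2⟩ | ⟨h1, h2⟩
  · obtain ⟨x, hx, hx0⟩ := intermediate_value_Icc' hpq hg ⟨h2.le, h1.le⟩
    exact h0 x hx hx0
  · obtain ⟨x, hx, hx0⟩ := intermediate_value_Icc hpq hg ⟨h1.le, h2.le⟩
    exact h0 x hx hx0

lemma aux_zero {g : ℝ → ℝ} {p q : ℝ} (hpq : p ≤ q) (hg : ContinuousOn g (Icc p q))
    (h0 : g p * g q < 0) : ∃ x ∈ Ioo p q, g x = 0 := by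
  by_contra hcon
  push Not at hcon
  refine absurd (aux_same hpq hg ?_) (not_lt.mpr h0.le)
  intro x hx hx0
  rcases eq_or_lt_of_le hx.1 with h1 | h1
  · subst h1; simp [hx0] at h0
  rcases eq_or_lt_of_le hx.2 with h2 | h2
  · subst h2; simp [hx0] at h0
  exact hcon x ⟨h1, h2⟩ hx0

lemma aux_change {g : ℝ → ℝ} {p q y : ℝ} (hpy : p < y) (hyq : y < q)
    (hg : ContinuousOn g (Icc p q)) (hs : ChangesSignAt g y)
    (h0 : ∀ x ∈ Icc p q, g x = 0 → x = y) : g p * g q < 0 := by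
  obtain ⟨ε, hε, hs⟩ := hs
  obtain ⟨u, hu1, hu2⟩ := exists_between (max_lt hpy (sub_lt_self y hε))
  obtain ⟨v, hv1, hv2⟩ := exists_between (lt_min hyq (lt_add_of_pos_right y hε))
  rw [max_lt_iff] at hu1
  rw [lt_min_iff] at hv2
  have h1 := hs u ⟨hu1.2, hu2⟩ v ⟨hv1, hv2.2⟩
  have h2 : 0 < g p * g u := aux_same hu1.1.le
    (hg.mono (Icc_subset_Icc le_rfl (by linarith)))
    (fun x hx hx0 => by
      have := h0 x ⟨hx.1, by linarith [hx.2]⟩ hx0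
      linarith [hx.2])
  have h3 : 0 < g v * g q := aux_same hv2.1.le
    (hg.mono (Icc_subset_Icc (by linarith) le_rfl))
    (fun x hx hx0 => by
      have := h0 x ⟨by linarith [hx.1], hx.2⟩ hx0
      linarith [hx.1])
  by_contra hcon
  have h4 := mul_pos h2 h3
  have h5 : (g p * g u) * (g v * g q) = (g p * g q) * (g u * g v) := by ring
  rw [h5] at h4
  exact absurd (mul_nonpos_of_nonneg_of_nonpos (not_lt.mp hcon) h1.le) (not_le.mpr h4)

lemma aux_sign {a : ℝ → ℝ} {I : Set ℝ} (ha : (∀ x ∈ I, 0 < a x) ∨ (∀ x ∈ I, a x < 0))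
    {x y : ℝ} (hx : x ∈ I) (hy : y ∈ I) : 0 < a x * a y := by
  rcases ha with ha | ha
  · exact mul_pos (ha x hx) (ha y hy)
  · exact mul_pos_of_neg_of_neg (ha x hx) (ha y hy)

lemma aux_next {h : ℝ → ℝ} {p q : ℝ} (hpq : p < q) (hh : ContinuousOn h (Icc p q))
    (hs : ChangesSignAt h p) (hq : h q = 0) :
    ∃ r, p < r ∧ r ≤ q ∧ h r = 0 ∧ ∀ x ∈ Ioo p r, h x ≠ 0 := by
  obtain ⟨ε, hε, hs⟩ := hs
  have hne : ∀ x ∈ Ioo p (p + ε), h x ≠ 0 := by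
    intro x hx hx0
    have := hs (p - ε / 2) ⟨by linarith, by linarith⟩ x hx
    simp [hx0] at this
  have hqe : p + ε ≤ q := by
    by_contra hcon
    exact hne q ⟨hpq, not_le.mp hcon⟩ hq
  have hcl : IsClosed (Icc (p + ε) q ∩ h ⁻¹' {0}) :=
    (hh.mono (Icc_subset_Icc (by linarith) le_rfl)).preimage_isClosed_of_isClosed
      isClosed_Icc isClosed_singleton
  have hcpt : IsCompact (Icc (p + ε) q ∩ h ⁻¹' {0}) :=
    isCompact_Icc.of_isClosed_subset hcl inter_subset_left
  obtain ⟨r, ⟨hr, hr0⟩, hmin⟩ := hcpt.exists_isLeast ⟨q, ⟨hqe, le_rfl⟩, hq⟩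
  refine ⟨r, by linarith [hr.1], hr.2, hr0, ?_⟩
  intro x hx hx0
  rcases lt_or_ge x (p + ε) with h1 | h1
  · exact hne x ⟨hx.1, h1⟩ hx0
  · have := hmin ⟨⟨h1, hx.2.le.trans hr.2⟩, hx0⟩
    linarith [hx.2]

lemma aux_half
    (I : Set ℝ) (hI : I.OrdConnected)
    (f g h a b c : ℝ → ℝ)
    (hf : ContinuousOn f I) (hg : ContinuousOn g I) (hh : ContinuousOn h I)
    (hgs : ∀ x ∈ interior I, g x = 0 → ChangesSignAt g x)
    (hhs : ∀ x ∈ interior I, h x = 0 → ChangesSignAt h x)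
    (heq : ∀ x ∈ I, a x * f x + b x * g x + c x * h x = 0)
    (ha : (∀ x ∈ I, 0 < a x) ∨ (∀ x ∈ I, a x < 0))
    (hb : (∀ x ∈ I, 0 < b x) ∨ (∀ x ∈ I, b x < 0))
    (hc : (∀ x ∈ I, 0 < c x) ∨ (∀ x ∈ I, c x < 0))
    (hfg : InterlaceHalf f g I) (hgf : InterlaceHalf g f I) (hhg : InterlaceHalf h g I) :
    InterlaceHalf f h I := by
  intro x₁ hx₁ x₂ hx₂ hlt hf₁ hf₂ hfne
  have hsub : Icc x₁ x₂ ⊆ I := hI.out hx₁ hx₂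
  have hint : Ioo x₁ x₂ ⊆ interior I :=
    interior_maximal (Ioo_subset_Icc_self.trans hsub) isOpen_Ioo
  obtain ⟨y, ⟨hy, hgy⟩, hyu⟩ := hfg x₁ hx₁ x₂ hx₂ hlt hf₁ hf₂ hfne
  have hyI : y ∈ I := hsub (Ioo_subset_Icc_self hy)
  have hg₁ : g x₁ ≠ 0 := by
    intro h0
    obtain ⟨z, ⟨hz, hz0⟩, -⟩ := hgf x₁ hx₁ y hyI hy.1 h0 hgy (fun x hx hx0 =>
      absurd (hyu x ⟨⟨hx.1, hx.2.trans hy.2⟩, hx0⟩) hx.2.ne)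
    exact hfne z ⟨hz.1, hz.2.trans hy.2⟩ hz0
  have hg₂ : g x₂ ≠ 0 := by
    intro h0
    obtain ⟨z, ⟨hz, hz0⟩, -⟩ := hgf y hyI x₂ hx₂ hy.2 hgy h0 (fun x hx hx0 =>
      absurd (hyu x ⟨⟨hy.1.trans hx.1, hx.2⟩, hx0⟩) hx.1.ne')
    exact hfne z ⟨hy.1.trans hz.1, hz.2⟩ hz0
  have hguniq : ∀ x ∈ Icc x₁ x₂, g x = 0 → x = y := by
    intro x hx hx0
    refine hyu x ⟨⟨lt_of_le_of_ne hx.1 ?_, lt_of_le_of_ne hx.2 ?_⟩, hx0⟩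
    · rintro rfl; exact hg₁ hx0
    · rintro rfl; exact hg₂ hx0
  have hgg : g x₁ * g x₂ < 0 :=
    aux_change hy.1 hy.2 (hg.mono hsub) (hgs y (hint hy) hgy) hguniq
  have hhh : h x₁ * h x₂ < 0 := by
    have e1 := heq x₁ hx₁
    have e2 := heq x₂ hx₂
    rw [hf₁] at e1
    rw [hf₂] at e2
    have e1' : c x₁ * h x₁ = -(b x₁ * g x₁) := by linarith
    have e2' : c x₂ * h x₂ = -(b x₂ * g x₂) := by linarith
    have hbb := aux_sign hb hx₁ hx₂
    have hcc := aux_sign hc hx₁ hx₂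
    have e : (c x₁ * c x₂) * (h x₁ * h x₂) = (b x₁ * b x₂) * (g x₁ * g x₂) := by
      calc _ = (c x₁ * h x₁) * (c x₂ * h x₂) := by ring
        _ = _ := by rw [e1', e2']; ring
    have := mul_neg_of_pos_of_neg hbb hgg
    rw [← e] at this
    exact (pos_iff_neg_of_mul_neg this).mp hcc
  have huniq : ∀ z ∈ Ioo x₁ x₂, ∀ w ∈ Ioo x₁ x₂, h z = 0 → h w = 0 → ¬ z < w := by
    intro z hz w hw hz0 hw0 hzw
    obtain ⟨r, hzr, hrw, hr0, hrn⟩ := aux_next hzw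
      (hh.mono ((Icc_subset_Icc hz.1.le hw.2.le).trans hsub)) (hhs z (hint hz) hz0) hw0
    have hr : r ∈ Ioo x₁ x₂ := ⟨hz.1.trans hzr, hrw.trans_lt hw.2⟩
    have hzI := hsub (Ioo_subset_Icc_self hz)
    have hrI := hsub (Ioo_subset_Icc_self hr)
    have hsub' : Icc z r ⊆ Icc x₁ x₂ := Icc_subset_Icc hz.1.le hr.2.le
    obtain ⟨t, ⟨ht, ht0⟩, -⟩ := hhg z hzI r hrI hzr hz0 hr0 hrn
    have hty := hguniq t (hsub' (Ioo_subset_Icc_self ht)) ht0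
    subst hty
    have hgzr : g z * g r < 0 := aux_change ht.1 ht.2 (hg.mono (hsub'.trans hsub))
      (hgs t (hint hy) hgy) (fun x hx => hguniq x (hsub' hx))
    have hfzr : 0 < f z * f r := aux_same hzr.le (hf.mono (hsub'.trans hsub))
      (fun x hx => hfne x ⟨hz.1.trans_le hx.1, hx.2.trans_lt hr.2⟩)
    have e1 := heq z hzI
    have e2 := heq r hrI
    rw [hz0] at e1
    rw [hr0] at e2
    have e1' : a z * f z = -(b z * g z) := by linarith
    have e2' : a r * f r = -(b r * g r) := by linarith
    have e : (a z * a r) * (f z * f r) = (b z * b r) * (g z * g r) := by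
      calc _ = (a z * f z) * (a r * f r) := by ring
        _ = _ := by rw [e1', e2']; ring
    have h1 := mul_pos (aux_sign ha hzI hrI) hfzr
    have h2 := mul_neg_of_pos_of_neg (aux_sign hb hzI hrI) hgzr
    linarith
  obtain ⟨z, hz, hz0⟩ := aux_zero hlt.le (hh.mono hsub) hhh
  refine ⟨z, ⟨hz, hz0⟩, ?_⟩
  rintro w ⟨hw, hw0⟩
  exact le_antisymm (not_lt.mp (huniq z hz w hw hz0 hw0)) (not_lt.mp (huniq w hw z hz hw0 hz0))

/-- Conditional transitivity of interlacing: if `a f + b g + c h = 0` on an interval `I`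
with `a`, `b`, `c` of constant nonzero sign, `f`, `g`, `h` continuous on `I` changing sign
at each interior zero, and `f` interlaces `g` and `g` interlaces `h` on `I`, then `f`
interlaces `h` on `I`. -/
theorem interlaced_trans_of_three_term
    (I : Set ℝ) (hI : I.OrdConnected)
    (f g h a b c : ℝ → ℝ)
    (hf : ContinuousOn f I) (hg : ContinuousOn g I) (hh : ContinuousOn h I)
    (hfs : ∀ x ∈ interior I, f x = 0 → ChangesSignAt f x)
    (hgs : ∀ x ∈ interior I, g x = 0 → ChangesSignAt g x)
    (hhs : ∀ x ∈ interior I, h x = 0 → ChangesSignAt h x)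
    (heq : ∀ x ∈ I, a x * f x + b x * g x + c x * h x = 0)
    (ha : (∀ x ∈ I, 0 < a x) ∨ (∀ x ∈ I, a x < 0))
    (hb : (∀ x ∈ I, 0 < b x) ∨ (∀ x ∈ I, b x < 0))
    (hc : (∀ x ∈ I, 0 < c x) ∨ (∀ x ∈ I, c x < 0))
    (hfg : InterlacedOn f g I) (hgh : InterlacedOn g h I) :
    InterlacedOn f h I := by
  exact ⟨aux_half I hI f g h a b c hf hg hh hgs hhs heq ha hb hc hfg.1 hfg.2 hgh.2,
    aux_half I hI h g f c b a hh hg hf hgs hfs (fun x hx => by linarith [heq x hx])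
      hc hb ha hgh.2 hgh.1 hfg.1⟩
end

section
/- Let δ be a fixed real number and let ν > 0. Then the positive zeros of the cylinder functions C_ν and C_{ν+2} are interlaced on (0,∞). -/
open Real Filter Topology Set

/-! ### Zeros of real functions -/

lemma aux_exists_pos_right {φ : ℝ → ℝ} {d a b : ℝ} (hab : a < b) (h : HasDerivAt φ d a)
    (h0 : φ a = 0) (hd : 0 < d) : ∃ c ∈ Ioo a b, ∀ x ∈ Ioc a c, 0 < φ x := by
  have h1 := eventually_nhdsWithin_sign_eq_of_deriv_pos (f := φ) (x₀ := a)
    (by rw [h.deriv]; exact hd) h0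
  obtain ⟨ε, hε, H⟩ := Metric.eventually_nhds_iff.1 h1
  refine ⟨a + min (ε / 2) ((b - a) / 2), ⟨?_, ?_⟩, ?_⟩
  · have : 0 < min (ε / 2) ((b - a) / 2) := lt_min (by linarith) (by linarith)
    linarith
  · have := min_le_right (ε / 2) ((b - a) / 2)
    linarith
  · rintro x ⟨hx1, hx2⟩
    have := min_le_left (ε / 2) ((b - a) / 2)
    have h2 := @H x (by rw [Real.dist_eq, abs_of_pos (by linarith)]; linarith)
    rw [sign_pos (sub_pos.2 hx1)] at h2
    exact sign_eq_one_iff.1 h2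

lemma aux_exists_neg_left {φ : ℝ → ℝ} {d a b : ℝ} (hab : a < b) (h : HasDerivAt φ d b)
    (h0 : φ b = 0) (hd : 0 < d) : ∃ c ∈ Ioo a b, φ c < 0 := by
  have h' : HasDerivAt (fun x => -φ (-x)) d (-b) := by
    have h1 : HasDerivAt φ d (-(-b)) := by simpa using h
    have h2 := (h1.comp (-b) (hasDerivAt_neg (-b))).fun_neg
    simpa [Function.comp_def] using h2
  obtain ⟨c, hc, H⟩ := aux_exists_pos_right (b := -a) (by linarith) h' (by simp [h0]) hd
  refine ⟨-c, ⟨by linarith [hc.2], by linarith [hc.1]⟩, ?_⟩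
  have := H c ⟨hc.1, le_rfl⟩
  linarith

lemma aux_zero_between_pos {φ : ℝ → ℝ} {d e a b : ℝ} (hab : a < b)
    (hcont : ContinuousOn φ (Icc a b))
    (ha : HasDerivAt φ d a) (hb : HasDerivAt φ e b) (ha0 : φ a = 0) (hb0 : φ b = 0)
    (hd : 0 < d) (he : 0 < e) : ∃ c ∈ Ioo a b, φ c = 0 := by
  obtain ⟨p, hp, H⟩ := aux_exists_pos_right hab ha ha0 hd
  obtain ⟨q, hq, H'⟩ := aux_exists_neg_left hab hb hb0 he
  have hpp := H p ⟨hp.1, le_rfl⟩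
  have hpc : IsPreconnected (Ioo a b) := isPreconnected_Ioo
  have := hpc.intermediate_value hq hp (hcont.mono Ioo_subset_Icc_self)
  obtain ⟨c, hc, hc0⟩ := this (show (0 : ℝ) ∈ Icc (φ q) (φ p) from ⟨H'.le, hpp.le⟩)
  exact ⟨c, hc, hc0⟩

lemma aux_zero_between {φ : ℝ → ℝ} {d e a b : ℝ} (hab : a < b)
    (hcont : ContinuousOn φ (Icc a b))
    (ha : HasDerivAt φ d a) (hb : HasDerivAt φ e b) (ha0 : φ a = 0) (hb0 : φ b = 0)
    (hde : 0 < d * e) : ∃ c ∈ Ioo a b, φ c = 0 := by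
  rcases pos_and_pos_or_neg_and_neg_of_mul_pos hde with ⟨h1, h2⟩ | ⟨h1, h2⟩
  · exact aux_zero_between_pos hab hcont ha hb ha0 hb0 h1 h2
  · obtain ⟨c, hc, h⟩ := aux_zero_between_pos (φ := fun x => -φ x) hab hcont.neg ha.neg hb.neg
      (by simp [ha0]) (by simp [hb0]) (neg_pos.2 h1) (neg_pos.2 h2)
    exact ⟨c, hc, neg_eq_zero.1 h⟩

lemma aux_no_two_zeros_pos {φ φ' : ℝ → ℝ} {p q : ℝ} (hpq : p < q)
    (hd : ∀ x ∈ Icc p q, HasDerivAt φ (φ' x) x) (hp : φ p = 0) (hq : φ q = 0)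
    (hpos : ∀ x ∈ Icc p q, φ x = 0 → 0 < φ' x) : False := by
  have hcont : ContinuousOn φ (Icc p q) := fun x hx => (hd x hx).continuousAt.continuousWithinAt
  have hpm : p ∈ Icc p q := ⟨le_rfl, hpq.le⟩
  obtain ⟨c, hc, H⟩ := aux_exists_pos_right hpq (hd p hpm) hp (hpos p hpm hp)
  have hcont2 : ContinuousOn φ (Icc c q) := hcont.mono (Icc_subset_Icc hc.1.le le_rfl)
  have hcomp : IsCompact (Icc c q ∩ φ ⁻¹' {0}) :=
    isCompact_Icc.of_isClosed_subset
      (hcont2.preimage_isClosed_of_isClosed isClosed_Icc isClosed_singleton) inter_subset_left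
  obtain ⟨m, ⟨⟨hm1, hm2⟩, hm0⟩, hmin⟩ :=
    hcomp.exists_isLeast ⟨q, ⟨hc.2.le, le_rfl⟩, hq⟩
  have hpm' : p < m := lt_of_lt_of_le hc.1 hm1
  have hmm : m ∈ Icc p q := ⟨hpm'.le, hm2⟩
  obtain ⟨z, hz, hz0⟩ := aux_zero_between_pos hpm' (hcont.mono (Icc_subset_Icc le_rfl hm2))
    (hd p hpm) (hd m hmm) hp hm0 (hpos p hpm hp) (hpos m hmm hm0)
  rcases le_or_gt z c with h | h
  · exact absurd hz0 (H z ⟨hz.1, h⟩).ne'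
  · have := hmin ⟨⟨h.le, hz.2.le.trans hm2⟩, hz0⟩
    exact absurd hz.2 (not_lt.2 this)

lemma aux_const_sign {f : ℝ → ℝ} {s : Set ℝ} (hs : IsPreconnected s) (hf : ContinuousOn f s)
    (h0 : ∀ x ∈ s, f x ≠ 0) : (∀ x ∈ s, 0 < f x) ∨ (∀ x ∈ s, f x < 0) := by
  by_contra! hcon
  obtain ⟨⟨x, hx, hx'⟩, ⟨y, hy, hy'⟩⟩ := hcon
  obtain ⟨z, hz, hz0⟩ := hs.intermediate_value hx hy hf ⟨hx', hy'⟩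
  exact h0 z hz hz0

lemma aux_interlaceHalf {f g f' g' : ℝ → ℝ}
    (hf : ∀ x, 0 < x → HasDerivAt f (f' x) x) (hg : ∀ x, 0 < x → HasDerivAt g (g' x) x)
    (h1 : ∀ x, 0 < x → f x = 0 → g x * f' x < 0)
    (h2 : ∀ x, 0 < x → g x = 0 → 0 < f x * g' x) : InterlaceHalf f g (Ioi 0) := by
  intro a ha b hb hab hfa hfb hne
  have ha' : 0 < a := ha
  have hcf : ∀ s ⊆ Icc a b, ContinuousOn f s := fun s hs x hx =>
    (hf x (ha'.trans_le (hs hx).1)).continuousAt.continuousWithinAt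
  have hcg : ∀ s ⊆ Icc a b, ContinuousOn g s := fun s hs x hx =>
    (hg x (ha'.trans_le (hs hx).1)).continuousAt.continuousWithinAt
  have huniq : ∀ p ∈ Ioo a b, ∀ q ∈ Ioo a b, p < q → g p = 0 → g q = 0 → False := by
    intro p hp q hq hpq hgp hgq
    have hsub : Icc p q ⊆ Ioo a b := fun x hx => ⟨hp.1.trans_le hx.1, hx.2.trans_lt hq.2⟩
    have hxpos : ∀ x ∈ Icc p q, 0 < x := fun x hx => ha'.trans (hsub hx).1
    rcases aux_const_sign (isPreconnected_Icc (a := p) (b := q))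
      (hcf _ (hsub.trans Ioo_subset_Icc_self)) (fun x hx => hne x (hsub hx)) with hs | hs
    · exact aux_no_two_zeros_pos hpq (fun x hx => hg x (hxpos x hx)) hgp hgq
        (fun x hx hx0 => pos_of_mul_pos_right (h2 x (hxpos x hx) hx0) (hs x hx).le)
    · refine aux_no_two_zeros_pos (φ := fun x => -g x) (φ' := fun x => -g' x) hpq
        (fun x hx => (hg x (hxpos x hx)).neg) (by simp [hgp]) (by simp [hgq])
        (fun x hx hx0 => ?_)
      have := h2 x (hxpos x hx) (neg_eq_zero.1 hx0)
      have h3 := hs x hx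
      by_contra hcon
      nlinarith
  have hex : ∃ c ∈ Ioo a b, g c = 0 := by
    by_contra! hcon
    have e1 := h1 a ha hfa
    have e2 := h1 b hb hfb
    have hno : ∀ x ∈ Icc a b, g x ≠ 0 := by
      intro x hx hx0
      rcases eq_or_lt_of_le hx.1 with h | h
      · subst h; simp [hx0] at e1
      rcases eq_or_lt_of_le hx.2 with h' | h'
      · subst h'; simp [hx0] at e2
      exact hcon x ⟨h, h'⟩ hx0
    have hprod : 0 < f' a * f' b := by
      rcases aux_const_sign (isPreconnected_Icc (a := a) (b := b)) (hcg _ subset_rfl) hno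
        with hs | hs
      · have g1 := hs a ⟨le_rfl, hab.le⟩
        have g2 := hs b ⟨hab.le, le_rfl⟩
        exact mul_pos_of_neg_of_neg (neg_of_mul_neg_right e1 g1.le)
          (neg_of_mul_neg_right e2 g2.le)
      · have g1 := hs a ⟨le_rfl, hab.le⟩
        have g2 := hs b ⟨hab.le, le_rfl⟩
        apply mul_pos
        · by_contra hh; nlinarith
        · by_contra hh; nlinarith
    obtain ⟨c, hc, hc0⟩ := aux_zero_between hab (hcf _ subset_rfl) (hf a ha) (hf b hb)
      hfa hfb hprod
    exact hne c hc hc0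
  obtain ⟨c, hc, hc0⟩ := hex
  refine ⟨c, ⟨hc, hc0⟩, ?_⟩
  rintro y ⟨hy, hy0⟩
  rcases lt_trichotomy y c with h | h | h
  · exact (huniq y hy c hc h hy0 hc0).elim
  · exact h
  · exact (huniq c hc y hy h hc0 hy0).elim

/-! ### The reciprocal Gamma function -/

/-- The reciprocal Gamma function on the reals. -/
noncomputable def rGam (s : ℝ) : ℝ := (Real.Gamma s)⁻¹

lemma rGam_eq_re : rGam = fun s : ℝ => ((fun z : ℂ => (Complex.Gamma z)⁻¹) (s : ℂ)).re := by
  funext s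
  simp only [rGam]
  rw [Complex.Gamma_ofReal, ← Complex.ofReal_inv, Complex.ofReal_re]

lemma rGam_contDiff : ContDiff ℝ 1 rGam := by
  rw [rGam_eq_re]
  exact (Complex.differentiable_one_div_Gamma.contDiff (n := 1)).real_of_complex

lemma rGam_hasDerivAt (s : ℝ) : HasDerivAt rGam (deriv rGam s) s :=
  ((rGam_contDiff.differentiable one_ne_zero) s).hasDerivAt

lemma rGam_rec (s : ℝ) : rGam s = s * rGam (s + 1) := by
  unfold rGam
  rcases eq_or_ne s 0 with h | h
  · subst h; simp [Real.Gamma_zero]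
  · rw [Real.Gamma_add_one h, mul_inv, ← mul_assoc, mul_inv_cancel₀ h, one_mul]

lemma rGam_deriv_rec (s : ℝ) :
    deriv rGam s = rGam (s + 1) + s * deriv rGam (s + 1) := by
  have h1 : HasDerivAt (fun s => s * rGam (s + 1))
      (1 * rGam (s + 1) + s * deriv rGam (s + 1)) s :=
    (hasDerivAt_id s).mul ((rGam_hasDerivAt (s + 1)).comp_add_const s 1)
  have h2 : rGam = fun s => s * rGam (s + 1) := funext rGam_rec
  rw [← h2] at h1
  rw [h1.deriv, one_mul]

lemma rGam_bound_aux (R : ℝ) (hR2 : R ≤ 2) : ∃ C, 0 ≤ C ∧ ∀ s, R ≤ s → |rGam s| ≤ C ∧ |deriv rGam s| ≤ C := by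
  obtain ⟨C1, h1⟩ := (isCompact_Icc (a := R) (b := 3)).exists_bound_of_continuousOn
    rGam_contDiff.continuous.continuousOn
  obtain ⟨C2, h2⟩ := (isCompact_Icc (a := R) (b := 3)).exists_bound_of_continuousOn
    (rGam_contDiff.continuous_deriv le_rfl).continuousOn
  obtain ⟨C, hC⟩ : ∃ C, C = max 0 (max C1 C2) := ⟨_, rfl⟩
  have hC0 : 0 ≤ C := hC ▸ le_max_left _ _
  have hC1 : C1 ≤ C := hC ▸ (le_max_left _ _).trans (le_max_right _ _)
  have hC2 : C2 ≤ C := hC ▸ (le_max_right _ _).trans (le_max_right _ _)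
  have key : ∀ k : ℕ, ∀ s, R ≤ s → s ≤ 3 + k → |rGam s| ≤ C ∧ |deriv rGam s| ≤ C := by
    intro k
    induction k with
    | zero =>
      intro s hs hs'
      have hm : s ∈ Icc R 3 := ⟨hs, by simpa using hs'⟩
      exact ⟨(h1 s hm).trans hC1, (h2 s hm).trans hC2⟩
    | succ k ih =>
      intro s hs hs'
      push_cast at hs'
      rcases le_or_gt s 3 with h | h
      · have hm : s ∈ Icc R 3 := ⟨hs, h⟩
        exact ⟨(h1 s hm).trans hC1, (h2 s hm).trans hC2⟩
      rcases le_or_gt s (3 + k) with h' | h'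
      · exact ih s hs h'
      have hR : R ≤ s - 1 := by linarith
      · obtain ⟨a1, a2⟩ := ih (s - 1) hR (by linarith)
        have r1 := rGam_rec (s - 1)
        have r2 := rGam_deriv_rec (s - 1)
        rw [sub_add_cancel] at r1 r2
        have b1 : (s - 1) * |rGam s| ≤ C := by
          rwa [r1, abs_mul, abs_of_pos (by linarith)] at a1
        have b3 : |rGam s| ≤ C / 2 := by nlinarith [abs_nonneg (rGam s)]
        have b2 : (s - 1) * |deriv rGam s| ≤ C + C / 2 := by
          have : (s - 1) * deriv rGam s = deriv rGam (s - 1) - rGam s := by rw [r2]; ring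
          calc (s - 1) * |deriv rGam s| = |(s - 1) * deriv rGam s| := by
                rw [abs_mul, abs_of_pos (by linarith : 0 < s - 1)]
            _ ≤ _ := by rw [this]; exact (abs_sub _ _).trans (add_le_add a2 b3)
        exact ⟨by linarith, by nlinarith [abs_nonneg (deriv rGam s)]⟩
  refine ⟨C, hC0, fun s hs => ?_⟩
  obtain ⟨k, hk⟩ := exists_nat_ge s
  exact key k s hs (by linarith)

lemma rGam_bound (R : ℝ) : ∃ C, 0 ≤ C ∧ ∀ s, R ≤ s → |rGam s| ≤ C ∧ |deriv rGam s| ≤ C := by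
  obtain ⟨C, h0, h⟩ := rGam_bound_aux (min R 2) (min_le_right _ _)
  exact ⟨C, h0, fun s hs => h s ((min_le_left _ _).trans hs)⟩

/-! ### Exponential-type power series -/

/-- The power series with coefficients `b m / m!`. -/
noncomputable def expS (b : ℕ → ℝ) (z : ℝ) : ℝ := ∑' m : ℕ, b m * z ^ m / m.factorial

lemma expS_summable {b : ℕ → ℝ} {C : ℝ} (hb : ∀ m, |b m| ≤ C) (z : ℝ) :
    Summable fun m : ℕ => b m * z ^ m / m.factorial := by
  refine Summable.of_norm_bounded (g := fun m : ℕ => C * (|z| ^ m / m.factorial))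
    ((Real.summable_pow_div_factorial |z|).mul_left C) (fun m => ?_)
  rw [Real.norm_eq_abs, abs_div, abs_mul, abs_pow, Nat.abs_cast, mul_div_assoc]
  exact mul_le_mul_of_nonneg_right (hb m) (by positivity)

lemma expS_term_succ (b : ℕ → ℝ) (z : ℝ) (m : ℕ) :
    b (m + 1) * (((m + 1 : ℕ) : ℝ) * z ^ (m + 1 - 1)) / (m + 1).factorial
      = b (m + 1) * z ^ m / m.factorial := by
  rw [Nat.factorial_succ]
  have h1 : (m.factorial : ℝ) ≠ 0 := by positivity
  have h2 : ((m + 1 : ℕ) : ℝ) ≠ 0 := by positivity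
  simp only [Nat.add_sub_cancel, Nat.cast_mul]
  field_simp

lemma expS_hasDerivAt {b : ℕ → ℝ} {C : ℝ} (hb : ∀ m, |b m| ≤ C) (z : ℝ) :
    HasDerivAt (expS b) (expS (fun m => b (m + 1)) z) z := by
  have hb1 : ∀ m, |(fun m => b (m + 1)) m| ≤ C := fun m => hb (m + 1)
  have hC0 : 0 ≤ C := (abs_nonneg _).trans (hb 0)
  have hr : 0 < |z| + 1 := by positivity
  have hu : Summable fun n : ℕ => C * ((n : ℝ) * (|z| + 1) ^ (n - 1)) / n.factorial := by
    rw [← summable_nat_add_iff 1]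
    have := expS_summable (b := fun _ => C) (C := |C|) (fun _ => le_rfl) (|z| + 1)
    exact this.congr (fun m => (expS_term_succ (fun _ => C) (|z| + 1) m).symm)
  have key := hasDerivAt_tsum_of_isPreconnected (g := fun (n : ℕ) y => b n * y ^ n / n.factorial)
    (g' := fun (n : ℕ) y => b n * ((n : ℝ) * y ^ (n - 1)) / n.factorial)
    (t := Metric.ball (0 : ℝ) (|z| + 1)) (y₀ := z) (y := z) hu Metric.isOpen_ball
    (convex_ball _ _).isPreconnected
    (fun n y _ => ((hasDerivAt_pow n y).const_mul (b n)).div_const _)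
    (fun n y hy => by
      have hy' : |y| ≤ |z| + 1 := by
        rw [mem_ball_zero_iff, Real.norm_eq_abs] at hy; exact hy.le
      rw [Real.norm_eq_abs, abs_div, abs_mul, abs_mul, abs_pow, Nat.abs_cast, Nat.abs_cast]
      have := hb n
      gcongr)
    (by rw [mem_ball_zero_iff, Real.norm_eq_abs]; linarith)
    (expS_summable hb z)
    (by rw [mem_ball_zero_iff, Real.norm_eq_abs]; linarith)
  have hs : Summable fun n : ℕ => b n * ((n : ℝ) * z ^ (n - 1)) / n.factorial := by
    rw [← summable_nat_add_iff 1]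
    exact (expS_summable hb1 z).congr (fun m => (expS_term_succ b z m).symm)
  rw [hs.tsum_eq_zero_add] at key
  simp only [expS_term_succ, Nat.cast_zero, zero_mul, mul_zero, zero_div, zero_add] at key
  exact key

/-! ### The entire function `Φ` and its derivative in the order -/

noncomputable def bPhi (μ z : ℝ) : ℝ := expS (fun m => (-1) ^ m * rGam (m + μ + 1)) z

noncomputable def bPhiD (μ z : ℝ) : ℝ := expS (fun m => (-1) ^ m * deriv rGam (m + μ + 1)) z

lemma bPhi_coeff_bound (μ : ℝ) : ∃ C, ∀ m : ℕ, |(-1 : ℝ) ^ m * rGam (m + μ + 1)| ≤ C ∧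
    |(-1 : ℝ) ^ m * deriv rGam (m + μ + 1)| ≤ C := by
  obtain ⟨C, _, h⟩ := rGam_bound (μ + 1)
  refine ⟨C, fun m => ?_⟩
  have hm : (0 : ℝ) ≤ m := by positivity
  simpa [abs_mul] using h (m + μ + 1) (by linarith)

lemma bPhi_hasDerivAt (μ z : ℝ) : HasDerivAt (bPhi μ) (-bPhi (μ + 1) z) z := by
  obtain ⟨C, h⟩ := bPhi_coeff_bound μ
  have := expS_hasDerivAt (fun m => (h m).1) z
  refine HasDerivAt.congr_deriv (f := bPhi μ) this ?_
  symm
  rw [bPhi, expS, expS, ← tsum_neg]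
  refine tsum_congr (fun m => ?_)
  push_cast
  rw [show (m : ℝ) + 1 + μ + 1 = m + (μ + 1) + 1 by ring]
  ring

lemma bPhiD_hasDerivAt (μ z : ℝ) : HasDerivAt (bPhiD μ) (-bPhiD (μ + 1) z) z := by
  obtain ⟨C, h⟩ := bPhi_coeff_bound μ
  have := expS_hasDerivAt (fun m => (h m).2) z
  refine HasDerivAt.congr_deriv (f := bPhiD μ) this ?_
  symm
  rw [bPhiD, expS, expS, ← tsum_neg]
  refine tsum_congr (fun m => ?_)
  push_cast
  rw [show (m : ℝ) + 1 + μ + 1 = m + (μ + 1) + 1 by ring]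
  ring

lemma bPhi_hasDerivAt_order (μ z : ℝ) :
    HasDerivAt (fun μ => bPhi μ z) (bPhiD μ z) μ := by
  obtain ⟨C, hC0, h⟩ := rGam_bound μ
  obtain ⟨C', h'⟩ := bPhi_coeff_bound μ
  have hu : Summable fun n : ℕ => C * (|z| ^ n / n.factorial) :=
    (Real.summable_pow_div_factorial |z|).mul_left C
  exact hasDerivAt_tsum_of_isPreconnected
    (g := fun (n : ℕ) y => (-1) ^ n * rGam (n + y + 1) * z ^ n / n.factorial)
    (g' := fun (n : ℕ) y => (-1) ^ n * deriv rGam (n + y + 1) * z ^ n / n.factorial)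
    (t := Ioi (μ - 1)) (y₀ := μ) (y := μ) hu isOpen_Ioi isPreconnected_Ioi
    (fun n y _ => by
      have h1 : HasDerivAt (fun y => rGam (n + y + 1)) (deriv rGam (n + y + 1)) y := by
        have h2 : HasDerivAt (fun y : ℝ => (n : ℝ) + y + 1) 1 y :=
          ((hasDerivAt_id y).const_add (n : ℝ)).add_const 1
        simpa [Function.comp_def] using (rGam_hasDerivAt (n + y + 1)).comp y h2
      exact ((h1.const_mul _).mul_const _).div_const _)
    (fun n y hy => by
      have hy' : μ - 1 < y := hy
      have hn : (0 : ℝ) ≤ n := by positivity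
      have hb := (h (n + y + 1) (by linarith)).2
      rw [Real.norm_eq_abs, abs_div, abs_mul, abs_mul, abs_pow, abs_pow, Nat.abs_cast, abs_neg,
        abs_one, one_pow, one_mul, mul_div_assoc]
      gcongr)
    (by simp) (expS_summable (fun m => (h' m).1) z) (by simp)

lemma bPhi_rec (μ z : ℝ) : bPhi (μ - 1) z = μ * bPhi μ z - z * bPhi (μ + 1) z := by
  obtain ⟨C, h⟩ := bPhi_coeff_bound μ
  obtain ⟨C', h'⟩ := bPhi_coeff_bound (μ + 1)
  have s1 := (expS_summable (fun m => (h m).1) z).hasSum.mul_left μ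
  have s2 := (expS_summable (fun m => (h' m).1) z).hasSum.mul_left (-z)
  have s3 : HasSum (fun m : ℕ => (-1 : ℝ) ^ m * rGam (m + μ + 1) * (m * z ^ m) / m.factorial)
      (-z * bPhi (μ + 1) z) := by
    rw [← hasSum_nat_add_iff' 1]
    simp only [Finset.range_one, Finset.sum_singleton, Nat.cast_zero, zero_mul, mul_zero,
      zero_div, sub_zero]
    refine (congrArg (fun f => HasSum f (-z * bPhi (μ + 1) z)) (funext fun m => ?_)).mpr s2
    rw [Nat.factorial_succ]
    have h1 : (m.factorial : ℝ) ≠ 0 := by positivity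
    have h2 : ((m : ℝ) + 1) ≠ 0 := by positivity
    push_cast
    rw [show (m : ℝ) + 1 + μ + 1 = m + (μ + 1) + 1 by ring]
    field_simp
    ring
  have s4 := s1.add s3
  have : bPhi (μ - 1) z = μ * bPhi μ z + -z * bPhi (μ + 1) z := by
    rw [← show _ = μ * bPhi μ z + -z * bPhi (μ + 1) z from s4.tsum_eq]
    rw [bPhi, expS]
    refine tsum_congr (fun m => ?_)
    rw [show (m : ℝ) + (μ - 1) + 1 = m + μ by ring, rGam_rec (m + μ)]
    ring
  rw [this]; ring

lemma bPhi_zero (μ : ℝ) : bPhi μ 0 = rGam (μ + 1) := by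
  rw [bPhi, expS, tsum_eq_single 0]
  · simp
  · intro m hm; simp [hm]

lemma bPhi_wronskian (μ z : ℝ) :
    z * bPhi (μ + 1) z * bPhi (-μ) z + bPhi μ z * bPhi (-μ - 1) z
      = -Real.sin (μ * π) / π := by
  have hd : ∀ z, HasDerivAt (fun z => z * bPhi (μ + 1) z * bPhi (-μ) z +
      bPhi μ z * bPhi (-μ - 1) z) 0 z := by
    intro z
    have r1 := bPhi_rec (μ + 1) z
    have r2 := bPhi_rec (-μ) z
    have e1 := bPhi_hasDerivAt (-μ - 1) z
    rw [sub_add_cancel] at e1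
    have := (((hasDerivAt_id z).mul (bPhi_hasDerivAt (μ + 1) z)).mul
      (bPhi_hasDerivAt (-μ) z)).add ((bPhi_hasDerivAt μ z).mul e1)
    refine this.congr_deriv ?_
    rw [add_sub_cancel_right] at r1
    simp only [id, Pi.mul_apply]
    rw [r1, r2]
    ring
  have hc := is_const_of_deriv_eq_zero (fun z => (hd z).differentiableAt)
    (fun z => (hd z).deriv) z 0
  rw [hc, zero_mul, zero_mul, zero_add, bPhi_zero, bPhi_zero]
  have := Real.Gamma_mul_Gamma_one_sub (-μ)
  simp only [rGam]
  rw [← mul_inv, show (-μ - 1 + 1 : ℝ) = -μ by ring, mul_comm (Real.Gamma _),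
    show μ + 1 = 1 - -μ by ring, this, inv_div, mul_comm π, neg_mul, Real.sin_neg]

/-! ### Bessel functions of the first kind -/

lemma besselJ_eq (ν : ℝ) {x : ℝ} (hx : 0 < x) :
    besselJ ν x = (x / 2) ^ ν * bPhi ν ((x / 2) ^ 2) := by
  have hx2 : 0 < x / 2 := by positivity
  rw [besselJ, bPhi, expS, ← tsum_mul_left]
  refine tsum_congr (fun m => ?_)
  rw [Real.rpow_add hx2, show (2 * (m : ℝ)) = ((2 * m : ℕ) : ℝ) by push_cast; ring,
    Real.rpow_natCast, ← pow_mul, rGam]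
  rw [div_eq_mul_inv, mul_inv]
  ring

/-- The derivative of `besselJ` in the order. -/
noncomputable def besselJd (ν x : ℝ) : ℝ :=
  (x / 2) ^ ν * (Real.log (x / 2) * bPhi ν ((x / 2) ^ 2) + bPhiD ν ((x / 2) ^ 2))

lemma besselJ_hasDerivAt_order (ν : ℝ) {x : ℝ} (hx : 0 < x) :
    HasDerivAt (fun μ => besselJ μ x) (besselJd ν x) ν := by
  have hx2 : 0 < x / 2 := by positivity
  have h1 : HasDerivAt (fun μ : ℝ => (x / 2) ^ μ) (Real.log (x / 2) * 1 * (x / 2) ^ ν) ν :=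
    (hasDerivAt_id ν).const_rpow hx2
  have h2 := h1.mul (bPhi_hasDerivAt_order ν ((x / 2) ^ 2))
  have h3 : (fun μ => besselJ μ x) = fun μ => (x / 2) ^ μ * bPhi μ ((x / 2) ^ 2) :=
    funext fun μ => besselJ_eq μ hx
  rw [h3]
  refine h2.congr_deriv ?_
  rw [besselJd]; ring

lemma half_rpow_hasDerivAt (ν : ℝ) {x : ℝ} (hx : 0 < x) :
    HasDerivAt (fun x : ℝ => (x / 2) ^ ν) (ν / x * (x / 2) ^ ν) x := by
  have hx2 : 0 < x / 2 := by positivity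
  have h := ((hasDerivAt_id x).div_const 2).rpow_const (p := ν) (Or.inl hx2.ne')
  refine h.congr_deriv ?_
  simp only [id]
  rw [Real.rpow_sub_one hx2.ne']
  field_simp

lemma half_sq_hasDerivAt (x : ℝ) : HasDerivAt (fun x : ℝ => (x / 2) ^ 2) (x / 2) x := by
  have h := ((hasDerivAt_id x).div_const 2).pow 2
  refine h.congr_deriv ?_
  simp only [id]
  ring

lemma half_rpow_succ (ν : ℝ) {x : ℝ} (hx : 0 < x) :
    (x / 2) ^ (ν + 1) = (x / 2) ^ ν * (x / 2) :=
  Real.rpow_add_one (by positivity) ν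

lemma besselJ_hasDerivAt (ν : ℝ) {x : ℝ} (hx : 0 < x) :
    HasDerivAt (besselJ ν) (ν / x * besselJ ν x - besselJ (ν + 1) x) x := by
  have h1 := (half_rpow_hasDerivAt ν hx).mul
    ((bPhi_hasDerivAt ν ((x / 2) ^ 2)).comp x (half_sq_hasDerivAt x))
  have h2 : besselJ ν =ᶠ[𝓝 x] fun x => (x / 2) ^ ν * bPhi ν ((x / 2) ^ 2) := by
    filter_upwards [lt_mem_nhds hx] with y hy using besselJ_eq ν hy
  refine (HasDerivAt.congr_of_eventuallyEq h1 h2).congr_deriv ?_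
  rw [besselJ_eq ν hx, besselJ_eq _ hx, half_rpow_succ ν hx]
  simp only [Function.comp_apply]
  ring

lemma besselJd_hasDerivAt (ν : ℝ) {x : ℝ} (hx : 0 < x) :
    HasDerivAt (besselJd ν) (ν / x * besselJd ν x + besselJ ν x / x - besselJd (ν + 1) x) x := by
  have hl : HasDerivAt (fun x : ℝ => Real.log (x / 2)) (1 / x) x := by
    have h := ((hasDerivAt_id x).div_const 2).log (by simp [hx.ne'])
    refine h.congr_deriv ?_
    simp only [id]
    field_simp
  have h1 := (half_rpow_hasDerivAt ν hx).mul
    ((hl.mul ((bPhi_hasDerivAt ν ((x / 2) ^ 2)).comp x (half_sq_hasDerivAt x))).add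
      ((bPhiD_hasDerivAt ν ((x / 2) ^ 2)).comp x (half_sq_hasDerivAt x)))
  refine HasDerivAt.congr_deriv (f := besselJd ν) h1 ?_
  rw [besselJ_eq ν hx, besselJd, besselJd, half_rpow_succ ν hx]
  simp only [Function.comp_apply, Pi.add_apply, Pi.mul_apply]
  ring

lemma besselJ_rec (μ : ℝ) {x : ℝ} (hx : 0 < x) :
    besselJ (μ - 1) x = 2 * μ / x * besselJ μ x - besselJ (μ + 1) x := by
  have hx2 : 0 < x / 2 := by positivity
  rw [besselJ_eq _ hx, besselJ_eq _ hx, besselJ_eq _ hx, bPhi_rec, half_rpow_succ μ hx,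
    Real.rpow_sub_one hx2.ne']
  field_simp

lemma besselJd_rec (μ : ℝ) {x : ℝ} (hx : 0 < x) :
    besselJd (μ - 1) x
      = 2 / x * besselJ μ x + 2 * μ / x * besselJd μ x - besselJd (μ + 1) x := by
  have h1 : HasDerivAt (fun μ => besselJ (μ - 1) x) (besselJd (μ - 1) x) μ :=
    (besselJ_hasDerivAt_order (μ - 1) hx).comp_sub_const μ 1
  have h2 : HasDerivAt (fun μ => besselJ (μ + 1) x) (besselJd (μ + 1) x) μ :=
    (besselJ_hasDerivAt_order (μ + 1) hx).comp_add_const μ 1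
  have h3 : HasDerivAt (fun μ : ℝ => 2 * μ / x) (2 * 1 / x) μ :=
    ((hasDerivAt_id μ).const_mul 2).div_const x
  have h4 := (h3.mul (besselJ_hasDerivAt_order μ hx)).sub h2
  have h5 : (fun μ => besselJ (μ - 1) x)
      = fun μ => 2 * μ / x * besselJ μ x - besselJ (μ + 1) x := funext fun μ => besselJ_rec μ hx
  rw [h5] at h1
  rw [h1.unique h4]
  ring

lemma besselJ_wronskian (μ : ℝ) {x : ℝ} (hx : 0 < x) :
    besselJ (μ + 1) x * besselJ (-μ) x + besselJ μ x * besselJ (-μ - 1) x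
      = -(2 * Real.sin (μ * π) / (π * x)) := by
  have hx2 : 0 < x / 2 := by positivity
  have h := bPhi_wronskian μ ((x / 2) ^ 2)
  rw [besselJ_eq _ hx, besselJ_eq _ hx, besselJ_eq _ hx, besselJ_eq _ hx, half_rpow_succ μ hx,
    Real.rpow_sub_one hx2.ne', Real.rpow_neg hx2.le]
  have hp : (x / 2) ^ μ ≠ 0 := (Real.rpow_pos_of_pos hx2 μ).ne'
  have h' : -(2 * Real.sin (μ * π) / (π * x)) = 2 / x * (-Real.sin (μ * π) / π) := by
    field_simp
  rw [h', ← h]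
  field_simp

lemma besselJ_neg_nat (n : ℕ) {x : ℝ} (hx : 0 < x) :
    besselJ (-(n : ℝ)) x = (-1) ^ n * besselJ n x := by
  induction n using Nat.twoStepInduction with
  | zero => simp
  | one =>
    have h := besselJ_rec 0 hx
    simp only [zero_sub, mul_zero, zero_div, zero_mul, zero_add] at h
    simp [h]
  | more n ih1 ih2 =>
    have h1 := besselJ_rec (-((n + 1 : ℕ) : ℝ)) hx
    have h2 := besselJ_rec ((n + 1 : ℕ) : ℝ) hx
    rw [ih2] at h1
    rw [show -((n + 1 : ℕ) : ℝ) + 1 = -(n : ℝ) by push_cast; ring, ih1] at h1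
    rw [show ((n + 1 : ℕ) : ℝ) - 1 = (n : ℝ) by push_cast; ring] at h2
    rw [show -((n + 2 : ℕ) : ℝ) = -((n + 1 : ℕ) : ℝ) - 1 by push_cast; ring, h1, h2,
      show ((n + 2 : ℕ) : ℝ) = ((n + 1 : ℕ) : ℝ) + 1 by push_cast; ring]
    ring

/-! ### Bessel functions of the second kind -/

/-- The quotient whose limit is `Y`. -/
noncomputable def besselA (x μ : ℝ) : ℝ :=
  (besselJ μ x * Real.cos (μ * π) - besselJ (-μ) x) / Real.sin (μ * π)

/-- Non-integer reals. -/
def nonInt : Set ℝ := {μ : ℝ | ∀ n : ℤ, μ ≠ (n : ℝ)}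

lemma nonInt_dense : Dense nonInt := by
  have h : nonInt = (Set.range ((↑) : ℤ → ℝ))ᶜ := by
    ext μ
    simp only [nonInt, mem_ofPred_eq, mem_compl_iff, mem_range, not_exists]
    exact ⟨fun h n hn => h n hn.symm, fun h n hn => h n hn.symm⟩
  rw [h]
  exact (Set.countable_range _).dense_compl ℝ

instance nonInt_neBot (ν : ℝ) : (𝓝[nonInt] ν).NeBot :=
  mem_closure_iff_nhdsWithin_neBot.1 (nonInt_dense ν)

lemma besselY_eq_of_tendsto {ν x l : ℝ} (h : Tendsto (besselA x) (𝓝[nonInt] ν) (𝓝 l)) :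
    besselY ν x = l := h.limUnder_eq

lemma sin_ne_zero_of_nonInt {μ : ℝ} (h : μ ∈ nonInt) : Real.sin (μ * π) ≠ 0 := by
  intro h0
  obtain ⟨n, hn⟩ := Real.sin_eq_zero_iff.1 h0
  exact h n (mul_right_cancel₀ Real.pi_ne_zero hn).symm

lemma besselNum_hasDerivAt (ν : ℝ) {x : ℝ} (hx : 0 < x) :
    HasDerivAt (fun μ => besselJ μ x * Real.cos (μ * π) - besselJ (-μ) x)
      (besselJd ν x * Real.cos (ν * π) + besselJ ν x * (-Real.sin (ν * π) * π)
        + besselJd (-ν) x) ν := by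
  have h1 : HasDerivAt (fun μ : ℝ => μ * π) π ν := by
    simpa using (hasDerivAt_id ν).mul_const π
  have h2 := (besselJ_hasDerivAt_order (-ν) hx).comp ν (hasDerivAt_neg ν)
  have h3 := ((besselJ_hasDerivAt_order ν hx).mul h1.cos).sub h2
  refine h3.congr_deriv ?_
  ring

lemma besselA_tendsto_nonInt {ν x : ℝ} (hν : ν ∈ nonInt) (hx : 0 < x) :
    Tendsto (besselA x) (𝓝[nonInt] ν) (𝓝 (besselA x ν)) := by
  have h : ContinuousAt (besselA x) ν :=
    (besselNum_hasDerivAt ν hx).continuousAt.div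
      (by fun_prop) (sin_ne_zero_of_nonInt hν)
  exact h.tendsto.mono_left nhdsWithin_le_nhds

lemma besselA_tendsto_nat (n : ℕ) {x : ℝ} (hx : 0 < x) :
    Tendsto (besselA x) (𝓝[nonInt] (n : ℝ))
      (𝓝 ((besselJd n x + (-1) ^ n * besselJd (-n) x) / π)) := by
  have hle : 𝓝[nonInt] (n : ℝ) ≤ 𝓝[≠] (n : ℝ) :=
    nhdsWithin_mono _ (fun μ hμ => by simpa using hμ n)
  have hs : HasDerivAt (fun μ : ℝ => Real.sin (μ * π)) (Real.cos (n * π) * π) n := by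
    have h1 : HasDerivAt (fun μ : ℝ => μ * π) π (n : ℝ) := by
      simpa using (hasDerivAt_id (n : ℝ)).mul_const π
    exact h1.sin
  have hcos : Real.cos (n * π) = (-1) ^ n := Real.cos_nat_mul_pi n
  have hsin : Real.sin (n * π) = 0 := Real.sin_nat_mul_pi n
  have hc2 : ((-1 : ℝ) ^ n) * (-1) ^ n = 1 := by rw [← mul_pow]; simp
  have hc0 : ((-1 : ℝ) ^ n) ≠ 0 := by simp
  have t1 := (besselNum_hasDerivAt n hx).tendsto_slope.mono_left hle
  have t2 := hs.tendsto_slope.mono_left hle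
  have t3 := t1.div t2 (by rw [hcos]; exact mul_ne_zero hc0 Real.pi_ne_zero)
  have e : (besselJd n x * Real.cos (n * π) + besselJ n x * (-Real.sin (n * π) * π)
        + besselJd (-n) x) / (Real.cos (n * π) * π)
      = (besselJd n x + (-1) ^ n * besselJd (-n) x) / π := by
    rw [hcos, hsin, div_eq_div_iff (mul_ne_zero hc0 Real.pi_ne_zero) Real.pi_ne_zero]
    linear_combination (-besselJd (-n) x * π) * hc2
  rw [e] at t3
  refine t3.congr' ?_
  filter_upwards [self_mem_nhdsWithin] with μ hμ
  have hne : μ - n ≠ 0 := sub_ne_zero.2 (by simpa using hμ n)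
  simp only [Pi.div_apply, slope_def_field, besselA]
  rw [hsin, hcos, besselJ_neg_nat n hx, mul_comm (besselJ n x), sub_self, sub_zero, sub_zero,
    div_div_div_cancel_right₀ hne]

lemma besselY_nat (n : ℕ) {x : ℝ} (hx : 0 < x) :
    besselY n x = (besselJd n x + (-1) ^ n * besselJd (-n) x) / π :=
  besselY_eq_of_tendsto (besselA_tendsto_nat n hx)

lemma besselY_nonInt {ν x : ℝ} (hν : ν ∈ nonInt) (hx : 0 < x) : besselY ν x = besselA x ν :=
  besselY_eq_of_tendsto (besselA_tendsto_nonInt hν hx)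

lemma nonInt_or_nat {ν : ℝ} (hν : 0 < ν) : ν ∈ nonInt ∨ ∃ n : ℕ, ν = n := by
  by_cases h : ν ∈ nonInt
  · exact Or.inl h
  · right
    simp only [nonInt, mem_ofPred_eq, not_forall, not_not] at h
    obtain ⟨k, hk⟩ := h
    have hk0 : 0 ≤ k := by
      have : (0 : ℝ) < k := hk ▸ hν
      exact_mod_cast this.le
    lift k to ℕ using hk0
    exact ⟨k, by simpa using hk⟩

lemma besselA_tendsto {ν x : ℝ} (hν : 0 < ν) (hx : 0 < x) :
    Tendsto (besselA x) (𝓝[nonInt] ν) (𝓝 (besselY ν x)) := by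
  rcases nonInt_or_nat hν with h | ⟨n, rfl⟩
  · rw [besselY_nonInt h hx]; exact besselA_tendsto_nonInt h hx
  · rw [besselY_nat n hx]; exact besselA_tendsto_nat n hx

lemma nonInt_add_nat {μ : ℝ} (h : μ ∈ nonInt) (k : ℕ) : μ + k ∈ nonInt := by
  intro n hn
  exact h (n - k) (by push_cast; linarith)

lemma besselA_tendsto_shift {ν x : ℝ} (hν : 0 < ν) (hx : 0 < x) (k : ℕ) :
    Tendsto (fun μ => besselA x (μ + k)) (𝓝[nonInt] ν) (𝓝 (besselY (ν + k) x)) := by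
  refine (besselA_tendsto (by positivity : 0 < ν + k) hx).comp ?_
  refine tendsto_nhdsWithin_iff.2 ⟨?_, ?_⟩
  · exact ((continuous_id.add continuous_const).tendsto ν).mono_left nhdsWithin_le_nhds
  · filter_upwards [self_mem_nhdsWithin] with μ hμ using nonInt_add_nat hμ k

lemma besselA_succ (μ x : ℝ) :
    besselA x (μ + 1)
      = (besselJ (μ + 1) x * Real.cos (μ * π) + besselJ (-μ - 1) x) / Real.sin (μ * π) := by
  rw [besselA, add_mul, one_mul, Real.cos_add_pi, Real.sin_add_pi,
    show -(μ + 1) = -μ - 1 by ring, div_neg, ← neg_div]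
  congr 1; ring

lemma besselA_succ_succ (μ x : ℝ) :
    besselA x (μ + 2)
      = (besselJ (μ + 2) x * Real.cos (μ * π) - besselJ (-μ - 2) x) / Real.sin (μ * π) := by
  rw [besselA, add_mul, Real.cos_add_two_pi, Real.sin_add_two_pi,
    show -(μ + 2) = -μ - 2 by ring]

lemma besselA_rec (μ : ℝ) {x : ℝ} (hx : 0 < x) :
    besselA x μ + besselA x (μ + 2) = 2 * (μ + 1) / x * besselA x (μ + 1) := by
  rw [besselA_succ, besselA_succ_succ, besselA]
  have h1 := besselJ_rec (μ + 1) hx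
  have h2 := besselJ_rec (-μ - 1) hx
  rw [add_sub_cancel_right, show μ + 1 + 1 = μ + 2 by ring] at h1
  rw [show -μ - 1 - 1 = -μ - 2 by ring, sub_add_cancel] at h2
  rw [h1, h2]
  ring

lemma besselY_rec {ν x : ℝ} (hν : 0 < ν) (hx : 0 < x) :
    besselY ν x + besselY (ν + 2) x = 2 * (ν + 1) / x * besselY (ν + 1) x := by
  have t0 := besselA_tendsto hν hx
  have t1 := besselA_tendsto_shift hν hx 1
  have t2 := besselA_tendsto_shift hν hx 2
  push_cast at t1 t2
  have t3 := t0.add t2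
  have tc : Tendsto (fun μ : ℝ => 2 * (μ + 1) / x) (𝓝[nonInt] ν) (𝓝 (2 * (ν + 1) / x)) :=
    ((by fun_prop : Continuous fun μ : ℝ => 2 * (μ + 1) / x).tendsto ν).mono_left
      nhdsWithin_le_nhds
  have t4 := tc.mul t1
  refine tendsto_nhds_unique t3 (t4.congr fun μ => (besselA_rec μ hx).symm)

lemma besselY_wronskian {ν x : ℝ} (hν : 0 < ν) (hx : 0 < x) :
    besselJ (ν + 1) x * besselY ν x - besselJ ν x * besselY (ν + 1) x = 2 / (π * x) := by
  have t0 := besselA_tendsto hν hx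
  have t1 := besselA_tendsto_shift hν hx 1
  push_cast at t1
  have j0 : Tendsto (fun μ => besselJ μ x) (𝓝[nonInt] ν) (𝓝 (besselJ ν x)) :=
    (besselJ_hasDerivAt_order ν hx).continuousAt.tendsto.mono_left nhdsWithin_le_nhds
  have j1 : Tendsto (fun μ => besselJ (μ + 1) x) (𝓝[nonInt] ν) (𝓝 (besselJ (ν + 1) x)) :=
    ((besselJ_hasDerivAt_order (ν + 1) hx).comp_add_const ν 1).continuousAt.tendsto.mono_left
      nhdsWithin_le_nhds
  refine tendsto_nhds_unique ((j1.mul t0).sub (j0.mul t1)) (tendsto_const_nhds.congr' ?_)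
  filter_upwards [self_mem_nhdsWithin] with μ hμ
  have hs := sin_ne_zero_of_nonInt hμ
  have hw := besselJ_wronskian μ hx
  rw [besselA_succ, besselA]
  have e : besselJ (μ + 1) x * ((besselJ μ x * Real.cos (μ * π) - besselJ (-μ) x)
        / Real.sin (μ * π))
      - besselJ μ x * ((besselJ (μ + 1) x * Real.cos (μ * π) + besselJ (-μ - 1) x)
        / Real.sin (μ * π))
      = -(besselJ (μ + 1) x * besselJ (-μ) x + besselJ μ x * besselJ (-μ - 1) x)
        / Real.sin (μ * π) := by ring
  rw [e, hw, neg_neg, mul_comm (2 : ℝ) (Real.sin _), mul_div_assoc, mul_div_cancel_left₀ _ hs]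

lemma besselY_hasDerivAt {ν x : ℝ} (hν : 0 < ν) (hx : 0 < x) :
    HasDerivAt (besselY ν) (ν / x * besselY ν x - besselY (ν + 1) x) x := by
  rcases nonInt_or_nat hν with h | ⟨n, rfl⟩
  · have he : besselY ν =ᶠ[𝓝 x] fun x => (besselJ ν x * Real.cos (ν * π) - besselJ (-ν) x)
        / Real.sin (ν * π) := by
      filter_upwards [lt_mem_nhds hx] with y hy using besselY_nonInt h hy
    have h1 := (((besselJ_hasDerivAt ν hx).mul_const (Real.cos (ν * π))).sub
      (besselJ_hasDerivAt (-ν) hx)).div_const (Real.sin (ν * π))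
    refine (HasDerivAt.congr_of_eventuallyEq h1 he).congr_deriv ?_
    have h2 : ν + 1 ∈ nonInt := by simpa using nonInt_add_nat h 1
    rw [besselY_nonInt h hx, besselY_nonInt h2 hx, besselA_succ, besselA]
    have h3 := besselJ_rec (-ν) hx
    rw [h3]
    ring
  · have he : besselY n =ᶠ[𝓝 x] fun x => (besselJd n x + (-1) ^ n * besselJd (-n) x) / π := by
      filter_upwards [lt_mem_nhds hx] with y hy using besselY_nat n hy
    have h1 := ((besselJd_hasDerivAt n hx).add
      ((besselJd_hasDerivAt (-n) hx).const_mul ((-1) ^ n))).div_const π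
    refine (HasDerivAt.congr_of_eventuallyEq h1 he).congr_deriv ?_
    have h2 := besselY_nat (n + 1) hx
    push_cast at h2
    rw [besselY_nat n hx, h2, show -((n : ℝ) + 1) = -n - 1 by ring, besselJd_rec (-n) hx,
      besselJ_neg_nat n hx]
    have hc2 : ((-1 : ℝ) ^ n) * (-1) ^ n = 1 := by rw [← mul_pow]; simp
    rw [pow_succ]
    linear_combination (-besselJ n x / x / π) * hc2

/-! ### Cylinder functions -/

lemma cylinder_hasDerivAt (δ : ℝ) {ν x : ℝ} (hν : 0 < ν) (hx : 0 < x) :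
    HasDerivAt (cylinder δ ν) (ν / x * cylinder δ ν x - cylinder δ (ν + 1) x) x := by
  have h := ((besselJ_hasDerivAt ν hx).const_mul (Real.cos δ)).sub
    ((besselY_hasDerivAt hν hx).const_mul (Real.sin δ))
  refine HasDerivAt.congr_deriv (f := cylinder δ ν) h ?_
  rw [cylinder, cylinder]; ring

lemma cylinder_rec (δ : ℝ) {ν x : ℝ} (hν : 0 < ν) (hx : 0 < x) :
    cylinder δ ν x + cylinder δ (ν + 2) x = 2 * (ν + 1) / x * cylinder δ (ν + 1) x := by
  have h1 := besselJ_rec (ν + 1) hx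
  rw [add_sub_cancel_right, show ν + 1 + 1 = ν + 2 by ring] at h1
  have h2 := besselY_rec hν hx
  rw [cylinder, cylinder, cylinder]
  linear_combination Real.cos δ * h1 - Real.sin δ * h2

lemma cylinder_ne (δ : ℝ) {ν x : ℝ} (hν : 0 < ν) (hx : 0 < x) (h0 : cylinder δ ν x = 0)
    (h1 : cylinder δ (ν + 1) x = 0) : False := by
  have hw := besselY_wronskian hν hx
  have hpos : 0 < 2 / (π * x) := by positivity
  rw [cylinder] at h0 h1
  have hc : Real.cos δ * (2 / (π * x)) = 0 := by
    rw [← hw]; linear_combination besselY ν x * h1 - besselY (ν + 1) x * h0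
  have hs : Real.sin δ * (2 / (π * x)) = 0 := by
    rw [← hw]; linear_combination besselJ ν x * h1 - besselJ (ν + 1) x * h0
  have hc' := (mul_eq_zero.1 hc).resolve_right hpos.ne'
  have hs' := (mul_eq_zero.1 hs).resolve_right hpos.ne'
  have := Real.sin_sq_add_cos_sq δ
  rw [hc', hs'] at this
  norm_num at this

lemma cylinder_hasDerivAt_two (δ : ℝ) {ν x : ℝ} (hν : 0 < ν) (hx : 0 < x) :
    HasDerivAt (cylinder δ (ν + 2))
      (cylinder δ (ν + 1) x - (ν + 2) / x * cylinder δ (ν + 2) x) x := by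
  refine (cylinder_hasDerivAt δ (by linarith : 0 < ν + 2) hx).congr_deriv ?_
  have h := cylinder_rec δ (by linarith : 0 < ν + 1) hx
  rw [show ν + 1 + 2 = ν + 2 + 1 by ring, show ν + 1 + 1 = ν + 2 by ring] at h
  linear_combination -h

/-- For `ν > 0`, the positive zeros of `C_ν` and `C_{ν+2}` are interlaced on `(0,∞)`. -/
theorem cylinder_interlaced_add_two (δ ν : ℝ) (hν : 0 < ν) :
    InterlacedOn (cylinder δ ν) (cylinder δ (ν + 2)) (Set.Ioi 0) := by
  have d1 := fun x (hx : 0 < x) => cylinder_hasDerivAt δ hν hx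
  have d2 := fun x (hx : 0 < x) => cylinder_hasDerivAt_two δ hν hx
  have h1 : ∀ x, 0 < x → cylinder δ ν x = 0 →
      cylinder δ (ν + 2) x * (ν / x * cylinder δ ν x - cylinder δ (ν + 1) x) < 0 := by
    intro x hx h0
    have hr := cylinder_rec δ hν hx
    have hne : cylinder δ (ν + 1) x ≠ 0 := fun h => cylinder_ne δ hν hx h0 h
    rw [h0, zero_add] at hr
    rw [hr, h0, mul_zero, zero_sub]
    have : 0 < 2 * (ν + 1) / x * (cylinder δ (ν + 1) x) ^ 2 := by positivity
    linarith
  have h2 : ∀ x, 0 < x → cylinder δ (ν + 2) x = 0 →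
      0 < cylinder δ ν x * (cylinder δ (ν + 1) x - (ν + 2) / x * cylinder δ (ν + 2) x) := by
    intro x hx h0
    have hr := cylinder_rec δ hν hx
    rw [h0, add_zero] at hr
    have hne : cylinder δ (ν + 1) x ≠ 0 := fun h =>
      cylinder_ne δ hν hx (by rw [hr, h, mul_zero]) h
    rw [hr, h0, mul_zero, sub_zero]
    have : 0 < 2 * (ν + 1) / x * (cylinder δ (ν + 1) x) ^ 2 := by positivity
    linarith
  refine ⟨aux_interlaceHalf d1 d2 h1 h2, ?_⟩
  have key : InterlaceHalf (cylinder δ (ν + 2)) (fun x => -cylinder δ ν x) (Ioi 0) :=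
    aux_interlaceHalf d2 (fun x hx => (d1 x hx).neg)
      (fun x hx h0 => by have := h2 x hx h0; linarith)
      (fun x hx h0 => by have := h1 x hx (neg_eq_zero.1 h0); linarith)
  intro a ha b hb hab hfa hfb hne
  simpa only [neg_eq_zero] using key a ha b hb hab hfa hfb hne
end
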